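/- arXiv:0806.0645 — 5 statements merged into one kernel-verified Lean document; each statement's English description precedes it below -/
import Mathlib

section
/- Let α = (√5 − 1)/2, let F_0 = F_1 = 1 and F_{k+1} = F_k + F_{k−1} be the Fibonacci numbers, and fix V, E ∈ ℝ. Define the one-step transfer matrices T(m,E) = [[E − V·χ_{[1−α,1)}(fract(mα)), −1], [1, 0]] for m ∈ ℤ, and set M_{−1} = [[1, −V], [0, 1]], M_0 = [[E, −1], [1, 0]], and M_k = T(F_k, E) · T(F_k − 1, E) · ⋯ · T(1, E) for k ≥ 1. Then M_{k+1} = M_{k−1} · M_k for all k ≥ 0. -/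
noncomputable section

/-- Consecutive pairs of Fibonacci numbers form a basis of `ℤ²`. -/
lemma exists_fib_coordinates {F : ℕ → ℕ} (hF0 : F 0 = 1) (hF1 : F 1 = 1)
    (hFrec : ∀ k, F (k + 2) = F (k + 1) + F k) (j : ℕ) (m n : ℤ) :
    ∃ a b : ℤ, m = a * F (j + 1) + b * F (j + 2) ∧ n = a * F j + b * F (j + 1) := by
  induction j with
  | zero =>
    refine ⟨2 * n - m, m - n, ?_, ?_⟩ <;> simp only [hFrec, zero_add, hF0, hF1] <;>
      push_cast <;> ring
  | succ j ih =>
    obtain ⟨a, b, hm, hn⟩ := ih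
    refine ⟨b - a, a, ?_, ?_⟩
    · rw [hm, hFrec (j + 1)]
      push_cast
      ring
    · rw [hn, hFrec j]
      push_cast
      ring

lemma fib_pos {F : ℕ → ℕ} (hF0 : F 0 = 1) (hF1 : F 1 = 1)
    (hFrec : ∀ k, F (k + 2) = F (k + 1) + F k) (j : ℕ) : 0 < F j := by
  induction j using Nat.twoStepInduction with
  | zero => omega
  | one => omega
  | more j h₀ h₁ => rw [hFrec]; omega

lemma fib_mul_sub_fib_ne_zero {F : ℕ → ℕ} {α : ℝ} (hα₀ : 0 < α) (hα₁ : α < 1)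
    (hα : α ^ 2 = 1 - α) (hF0 : F 0 = 1) (hF1 : F 1 = 1)
    (hFrec : ∀ k, F (k + 2) = F (k + 1) + F k) (j : ℕ) :
    (F (j + 1) * α - F j : ℝ) ≠ 0 := by
  induction j with
  | zero =>
    simp only [zero_add, hF0, hF1, Nat.cast_one, one_mul]
    linarith
  | succ j ih =>
    have h : (F (j + 1 + 1) * α - F (j + 1) : ℝ) = -α * (F (j + 1) * α - F j) := by
      rw [hFrec j]
      push_cast
      linear_combination (F (j + 1) : ℝ) * hα
    rw [h]
    exact mul_ne_zero (by linarith) ih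

/-- Every value `m * α - n` with `0 < m < F (j + 2)` is, relative to `F (j + 1) * α - F j`,
either at least `1` or less than `-1`. -/
lemma exists_ratio_fib_mul_sub_fib {F : ℕ → ℕ} {α : ℝ} (hα₀ : 0 < α)
    (hα : α ^ 2 = 1 - α) (hF0 : F 0 = 1) (hF1 : F 1 = 1)
    (hFrec : ∀ k, F (k + 2) = F (k + 1) + F k) (j : ℕ) (m n : ℤ)
    (hm₀ : 0 < m) (hm : m < F (j + 2)) :
    ∃ r : ℝ, (m * α - n : ℝ) = (F (j + 1) * α - F j) * r ∧ (1 ≤ r ∨ r < -1) := by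
  obtain ⟨a, b, hma, hnb⟩ := exists_fib_coordinates hF0 hF1 hFrec j m n
  have h₁ : (0 : ℤ) < F (j + 1) := by exact_mod_cast fib_pos hF0 hF1 hFrec (j + 1)
  have h₂ : (0 : ℤ) < F (j + 2) := by exact_mod_cast fib_pos hF0 hF1 hFrec (j + 2)
  refine ⟨a - α * b, ?_, ?_⟩
  · rw [hma, hnb, hFrec j]
    push_cast
    linear_combination (b * F (j + 1) : ℝ) * hα
  · rcases le_or_gt b 0 with hb | hb
    · left
      have ha : 1 ≤ a := by
        by_contra! h
        have : a ≤ 0 := by omega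
        nlinarith
      have ha' : (1 : ℝ) ≤ a := by exact_mod_cast ha
      have hb' : (b : ℝ) ≤ 0 := by exact_mod_cast hb
      nlinarith
    · right
      have ha : a ≤ -1 := by
        by_contra! h
        have : 0 ≤ a := by omega
        nlinarith
      have ha' : (a : ℝ) ≤ -1 := by exact_mod_cast ha
      have hb' : (0 : ℝ) < b := by exact_mod_cast hb
      nlinarith

lemma floor_fib_add_mul {F : ℕ → ℕ} {α : ℝ} (hα₀ : 0 < α) (hα₁ : α < 1)
    (hα : α ^ 2 = 1 - α) (hF0 : F 0 = 1) (hF1 : F 1 = 1)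
    (hFrec : ∀ k, F (k + 2) = F (k + 1) + F k) (j : ℕ) (m : ℤ)
    (hm₀ : 0 < m) (hm : m < F (j + 2)) :
    ⌊((F (j + 1) + m : ℤ) : ℝ) * α⌋ = ⌊(m : ℝ) * α⌋ + F j := by
  obtain ⟨r, hr, hr'⟩ :=
    exists_ratio_fib_mul_sub_fib hα₀ hα hF0 hF1 hFrec j m ⌊(m : ℝ) * α⌋ hm₀ hm
  obtain ⟨s, hs, hs'⟩ :=
    exists_ratio_fib_mul_sub_fib hα₀ hα hF0 hF1 hFrec j m (⌊(m : ℝ) * α⌋ + 1) hm₀ hm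
  have hx := fib_mul_sub_fib_ne_zero hα₀ hα₁ hα hF0 hF1 hFrec j
  have hl := Int.floor_le ((m : ℝ) * α)
  have hu := Int.lt_floor_add_one ((m : ℝ) * α)
  rw [Int.floor_eq_iff]
  push_cast at hs ⊢
  set x : ℝ := F (j + 1) * α - F j with hxdef
  have hl' : 0 ≤ x * (r + 1) := by
    rcases lt_or_gt_of_ne hx with h | h <;> rcases hr' with h' | h' <;> nlinarith
  have hu' : x * (s + 1) < 0 := by
    rcases lt_or_gt_of_ne hx with h | h <;> rcases hs' with h' | h' <;> nlinarith
  constructor <;> linarith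

lemma fract_mul_mem_Ico_iff (α : ℝ) (m : ℤ) :
    Int.fract ((m : ℝ) * α) ∈ Set.Ico (1 - α) 1 ↔
      ⌊(m : ℝ) * α⌋ + 1 ≤ ⌊((m + 1 : ℤ) : ℝ) * α⌋ := by
  rw [Int.le_floor, Set.mem_Ico, and_iff_left (Int.fract_lt_one _), Int.fract]
  push_cast
  constructor <;> intro h <;> linarith

/-- The Fibonacci potential is repeated after a shift by a Fibonacci number. -/
lemma fract_fib_add_mul_mem_Ico_iff {F : ℕ → ℕ} {α : ℝ} (hα₀ : 0 < α) (hα₁ : α < 1)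
    (hα : α ^ 2 = 1 - α) (hF0 : F 0 = 1) (hF1 : F 1 = 1)
    (hFrec : ∀ k, F (k + 2) = F (k + 1) + F k) (j : ℕ) (m : ℤ)
    (hm₀ : 0 < m) (hm : m + 1 < F (j + 2)) :
    Int.fract (((F (j + 1) + m : ℤ) : ℝ) * α) ∈ Set.Ico (1 - α) 1 ↔
      Int.fract ((m : ℝ) * α) ∈ Set.Ico (1 - α) 1 := by
  rw [fract_mul_mem_Ico_iff, fract_mul_mem_Ico_iff, add_assoc,
    floor_fib_add_mul hα₀ hα₁ hα hF0 hF1 hFrec j m hm₀ (by omega),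
    floor_fib_add_mul hα₀ hα₁ hα hF0 hF1 hFrec j (m + 1) (by omega) hm]
  omega

/-- The transfer matrices of the Fibonacci Hamiltonian over the Fibonacci blocks satisfy
`M_{k+1} = M_{k-1} * M_k`. Here `M n` stands for the matrix `M_{n-1}` of the paper. -/
theorem transfer_matrix_recursion (V E α : ℝ) (hα : α = (Real.sqrt 5 - 1) / 2)
    (F : ℕ → ℕ) (hF0 : F 0 = 1) (hF1 : F 1 = 1)
    (hFrec : ∀ k : ℕ, F (k + 2) = F (k + 1) + F k)
    (Tm : ℤ → Matrix (Fin 2) (Fin 2) ℝ)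
    (hTm : ∀ m : ℤ, Tm m =
      !![E - V * (if Int.fract ((m : ℝ) * α) ∈ Set.Ico (1 - α) 1 then (1:ℝ) else 0), -1; 1, 0])
    (M : ℕ → Matrix (Fin 2) (Fin 2) ℝ)
    (hM0 : M 0 = !![1, -V; 0, 1]) (hM1 : M 1 = !![E, -1; 1, 0])
    (hMk : ∀ k : ℕ, 1 ≤ k →
      M (k + 1) = ((List.range (F k)).map (fun i => Tm ((F k : ℤ) - (i : ℤ)))).prod) :
    ∀ k : ℕ, M (k + 2) = M k * M (k + 1) := by
  replace hMk : ∀ k : ℕ, 1 ≤ k →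
      M (k + 1) = ((List.range (F k)).map (fun i : ℕ => Tm ((F k : ℤ) - (i : ℤ)))).prod := by
    intro k hk
    rw [hMk k hk]
    simp [← List.map_eq_flatMap, Function.comp_def]
  have h5 : Real.sqrt 5 ^ 2 = 5 := Real.sq_sqrt (by norm_num)
  have h5₀ : 0 ≤ Real.sqrt 5 := Real.sqrt_nonneg 5
  have hα₀ : 1 / 2 < α := by rw [hα]; nlinarith
  have hα₁ : α < 2 / 3 := by rw [hα]; nlinarith
  have hα₂ : α ^ 2 = 1 - α := by rw [hα]; linear_combination h5 / 4
  clear hα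
  have hT1 : Tm 1 = !![E - V, -1; 1, 0] := by
    have hfl : Int.fract (((1 : ℤ) : ℝ) * α) = α := by
      rw [Int.cast_one, one_mul, Int.fract_eq_self]
      constructor <;> linarith
    rw [hTm, hfl, if_pos (by constructor <;> linarith), mul_one]
  have hT2 : Tm 2 = !![E, -1; 1, 0] := by
    have hfl : Int.fract (((2 : ℤ) : ℝ) * α) = 2 * α - 1 := by
      rw [Int.fract_eq_iff]
      exact ⟨by linarith, by linarith, 1, by push_cast; ring⟩
    rw [hTm, hfl, if_neg (by rintro ⟨h, -⟩; nlinarith), mul_zero, sub_zero]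
  have hF2 : F 2 = 2 := by rw [hFrec 0, hF0, zero_add, hF1]
  have hM2 : M 2 = Tm 1 := by
    rw [hMk 1 le_rfl, hF1]
    simp
  intro k
  match k with
  | 0 =>
    rw [hM2, hT1, hM0, zero_add, hM1]
    simp [sub_eq_add_neg]
  | 1 =>
    rw [hMk 2 (by omega), hF2, hM1, hM2, ← hT2]
    simp [List.range_succ]
  | j + 2 =>
    have h₁ := fib_pos hF0 hF1 hFrec j
    have h₂ := fib_pos hF0 hF1 hFrec (j + 1)
    have h₃ : F (j + 1 + 1) = F (j + 1) + F j := hFrec j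
    have h₄ := hFrec (j + 1)
    rw [hMk (j + 3) (by omega), hMk (j + 2) (by omega), hMk (j + 1) (by omega), h₄,
      add_comm (F (j + 1 + 1)), List.range_add, List.map_append, List.prod_append, List.map_map]
    congr 2
    · refine List.map_congr_left fun i hi => ?_
      rw [List.mem_range] at hi
      have hshift := fract_fib_add_mul_mem_Ico_iff (by linarith) (by linarith) hα₂ hF0 hF1 hFrec
        (j + 1) (F (j + 1) - i) (by omega) (by omega)
      rw [show ((F (j + 1) + F (j + 1 + 1) : ℕ) : ℤ) - i = F (j + 1 + 1) + (F (j + 1) - i) by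
        push_cast; ring, hTm, hTm (F (j + 1) - i)]
      simp only [hshift]
    · refine List.map_congr_left fun i _ => ?_
      simp only [Function.comp_apply]
      congr 1
      push_cast
      ring
end
end

section
/- (Sütő) For every V > 0, every ω ∈ [0,1), and every E ∈ ℝ: E belongs to the spectrum of the Fibonacci Hamiltonian H_{V,ω} if and only if the positive semiorbit of the point ((E−V)/2, E/2, 1) under iterates of the trace map T is bounded, i.e., there exists M > 0 such that ‖Tⁿ((E−V)/2, E/2, 1)‖ ≤ M for all n ≥ 0. -/
noncomputable section

/-- The trace map `T(x,y,z) = (2xy - z, x, y)`. -/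
def traceMap : ℝ × ℝ × ℝ → ℝ × ℝ × ℝ := fun p => (2 * p.1 * p.2.1 - p.2.2, p.1, p.2.1)


/-- The inverse golden ratio. -/
def goldInv : ℝ := (Real.sqrt 5 - 1) / 2

theorem goldInv_eq_neg_goldenConj : goldInv = -Real.goldenConj := by
  simp only [goldInv, Real.goldenConj]; ring

theorem goldInv_pos : 0 < goldInv := by
  rw [goldInv_eq_neg_goldenConj]; linarith [Real.goldenConj_neg]

theorem goldInv_lt_one : goldInv < 1 := by
  rw [goldInv_eq_neg_goldenConj]; linarith [Real.neg_one_lt_goldenConj]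

theorem goldInv_sq : goldInv ^ 2 = 1 - goldInv := by
  rw [goldInv_eq_neg_goldenConj, neg_sq, Real.goldenConj_sq]; ring

theorem goldInv_irrational : Irrational goldInv := by
  rw [goldInv_eq_neg_goldenConj]; exact Real.goldenConj_irrational.neg

theorem int_mul_goldInv_ne {j : ℤ} (hj : j ≠ 0) (c : ℤ) : (j : ℝ) * goldInv ≠ c :=
  (goldInv_irrational.intCast_mul hj).ne_int c

theorem fib_mul_goldInv_sub (k : ℕ) :
    (Nat.fib (k + 1) : ℝ) * goldInv - Nat.fib k = goldInv * (-goldInv) ^ k := by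
  induction k using Nat.twoStepInduction with
  | zero => simp
  | one => simp; linear_combination goldInv_sq
  | more n h1 h2 =>
    rw [Nat.fib_add_two (n := n), Nat.fib_add_two (n := n + 1)]
    push_cast
    rw [show n + 1 + 1 = n + 2 from rfl] at h2
    rw [pow_succ] at h2
    rw [pow_add]
    linear_combination h1 + h2 - goldInv * (-goldInv) ^ n * goldInv_sq

theorem exists_fib_combination (k : ℕ) (j c : ℤ) :
    ∃ a b : ℤ, j = a * Nat.fib (k + 1) + b * Nat.fib (k + 2) ∧
      c = a * Nat.fib k + b * Nat.fib (k + 1) := by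
  induction k with
  | zero => exact ⟨j - c, c, by simp, by simp⟩
  | succ k ih =>
    obtain ⟨a, b, h1, h2⟩ := ih
    refine ⟨b - a, a, ?_, ?_⟩
    · rw [h1, Nat.fib_add_two (n := k + 1)]; push_cast; ring
    · rw [h2, Nat.fib_add_two (n := k)]; push_cast; ring

/-- Best approximation property of the convergents of the inverse golden ratio. -/
theorem goldInv_pow_le_abs (k : ℕ) {j : ℤ} (hj : 0 < j) (hjk : j < Nat.fib (k + 2)) (c : ℤ) :
    goldInv ^ (k + 1) ≤ |(j : ℝ) * goldInv - c| := by
  obtain ⟨a, b, h1, h2⟩ := exists_fib_combination k j c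
  have hq : (0 : ℤ) < Nat.fib (k + 1) := by exact_mod_cast Nat.fib_pos.2 (by omega)
  have hα := goldInv_pos
  have key : (j : ℝ) * goldInv - c = goldInv * (-goldInv) ^ k * (a - b * goldInv) := by
    have e1 := fib_mul_goldInv_sub k
    have e2 := fib_mul_goldInv_sub (k + 1)
    rw [pow_succ] at e2
    rw [h1, h2]; push_cast
    linear_combination (a : ℝ) * e1 + b * e2
  rw [key, abs_mul, abs_mul, abs_pow, abs_neg, abs_of_pos hα, ← pow_succ']
  refine le_mul_of_one_le_right (by positivity) ?_
  rcases lt_trichotomy b 0 with hb | hb | hb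
  · have ha : 1 ≤ a := by
      by_contra! h
      nlinarith
    have ha' : (1 : ℝ) ≤ a := by exact_mod_cast ha
    have hb' : (b : ℝ) ≤ 0 := by exact_mod_cast hb.le
    exact le_trans (by nlinarith) (le_abs_self _)
  · subst hb
    have ha : 1 ≤ a := by
      by_contra! h
      nlinarith
    have ha' : (1 : ℝ) ≤ a := by exact_mod_cast ha
    exact le_trans (by simpa using ha') (le_abs_self _)
  · have ha : a ≤ -1 := by
      by_contra! h
      nlinarith
    have ha' : (a : ℝ) ≤ -1 := by exact_mod_cast ha
    have hb' : (0 : ℝ) ≤ b := by exact_mod_cast hb.le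
    exact le_trans (by nlinarith) (neg_le_abs _)

theorem floor_add_fib_mul_goldInv (k : ℕ) {j : ℤ} (hj : 0 < j) (hjk : j < Nat.fib (k + 2)) :
    ⌊((j + Nat.fib (k + 1) : ℤ) : ℝ) * goldInv⌋ = ⌊(j : ℝ) * goldInv⌋ + Nat.fib k := by
  set c := ⌊(j : ℝ) * goldInv⌋ with hc
  have h0 : (c : ℝ) ≤ j * goldInv := Int.floor_le _
  have h1 : (j : ℝ) * goldInv < c + 1 := Int.lt_floor_add_one _
  have b0 := goldInv_pow_le_abs k hj hjk c
  have b1 := goldInv_pow_le_abs k hj hjk (c + 1)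
  rw [abs_of_nonneg (by linarith)] at b0
  rw [abs_of_nonpos (by push_cast; linarith)] at b1
  have e := fib_mul_goldInv_sub k
  have habs : |goldInv * (-goldInv) ^ k| = goldInv ^ (k + 1) := by
    rw [abs_mul, abs_pow, abs_neg, abs_of_pos goldInv_pos, pow_succ']
  have l := neg_abs_le (goldInv * (-goldInv) ^ k)
  have u := le_abs_self (goldInv * (-goldInv) ^ k)
  rw [habs] at l u
  rw [Int.floor_eq_iff]
  push_cast at b1 ⊢
  refine ⟨by linarith, lt_of_le_of_ne (by linarith) ?_⟩
  have := int_mul_goldInv_ne (j := j + Nat.fib (k + 1)) (by positivity) (c + Nat.fib k + 1)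
  push_cast at this
  exact this

/-- The Fibonacci Sturmian sequence with phase `ω`. -/
def sturmian (ω : ℝ) (n : ℤ) : ℤ :=
  ⌊((n + 1 : ℤ) : ℝ) * goldInv + ω⌋ - ⌊(n : ℝ) * goldInv + ω⌋

theorem ite_fract_eq_sturmian (ω : ℝ) (n : ℤ) :
    (if Int.fract ((n : ℝ) * goldInv + ω) ∈ Set.Ico (1 - goldInv) 1 then (1 : ℂ) else 0) =
      (sturmian ω n : ℂ) := by
  have e : ((n + 1 : ℤ) : ℝ) * goldInv + ω = ((n : ℝ) * goldInv + ω) + goldInv := by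
    push_cast; ring
  have hf := Int.floor_add_fract ((n : ℝ) * goldInv + ω)
  have h0 := Int.fract_nonneg ((n : ℝ) * goldInv + ω)
  have h1 := Int.fract_lt_one ((n : ℝ) * goldInv + ω)
  have p0 := goldInv_pos
  have p1 := goldInv_lt_one
  unfold sturmian
  rw [e]
  split_ifs with h
  · have : ⌊(n : ℝ) * goldInv + ω + goldInv⌋ = ⌊(n : ℝ) * goldInv + ω⌋ + 1 := by
      rw [Int.floor_eq_iff]
      push_cast
      constructor <;> linarith [h.1]
    rw [this]; simp
  · have h' : Int.fract ((n : ℝ) * goldInv + ω) < 1 - goldInv := by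
      by_contra! h2
      exact h ⟨h2, h1⟩
    have : ⌊(n : ℝ) * goldInv + ω + goldInv⌋ = ⌊(n : ℝ) * goldInv + ω⌋ := by
      rw [Int.floor_eq_iff]
      constructor <;> linarith
    rw [this]; simp

/-- The sequences of all phases have the same finite windows. -/
theorem exists_sturmian_window (ω ω' : ℝ) (N m₀ : ℕ) :
    ∃ m : ℕ, m₀ ≤ m ∧ ∀ n : ℤ, |n| ≤ N → sturmian ω (n + m) = sturmian ω' n := by
  obtain ⟨δ, hδ, hδn⟩ : ∃ δ > 0, ∀ n ∈ Finset.Icc (-(N : ℤ) - 1) (N + 1),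
      δ ≤ 1 - Int.fract ((n : ℝ) * goldInv + ω') := by
    have hne : (Finset.Icc (-(N : ℤ) - 1) (N + 1)).Nonempty := ⟨0, by simp; omega⟩
    obtain ⟨n₀, -, hmin⟩ := Finset.exists_min_image _
      (fun n : ℤ => 1 - Int.fract ((n : ℝ) * goldInv + ω')) hne
    exact ⟨_, by linarith [Int.fract_lt_one ((n₀ : ℝ) * goldInv + ω')], hmin⟩
  have p0 := goldInv_pos
  have p1 := goldInv_lt_one
  obtain ⟨k, hk⟩ := exists_pow_lt_of_lt_one hδ p1
  set ε := goldInv ^ (2 * k + 1) with hε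
  have hε0 : 0 < ε := by positivity
  have hε1 : ε ≤ 1 := pow_le_one₀ p0.le p1.le
  have hεδ : ε < δ := lt_of_le_of_lt (pow_le_pow_of_le_one p0.le p1.le (by omega)) hk
  have hfib : (Nat.fib (2 * k + 1) : ℝ) * goldInv - Nat.fib (2 * k) = ε := by
    rw [fib_mul_goldInv_sub, (even_two_mul k).neg_pow, hε, pow_succ']
  obtain ⟨c, hc⟩ := exists_nat_ge (m₀ - (ω' - ω))
  set y := ω' - ω + c with hy
  have hym : (m₀ : ℝ) ≤ y := by linarith
  have hy0 : 0 ≤ y := le_trans (by positivity) hym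
  set j := ⌈y / ε⌉₊ with hj
  have j0 : y ≤ j * ε := by
    have := Nat.le_ceil (y / ε)
    rwa [div_le_iff₀ hε0] at this
  have j1 : j * ε < y + ε := by
    have := Nat.ceil_lt_add_one (a := y / ε) (by positivity)
    rw [← hj] at this
    calc (j : ℝ) * ε < (y / ε + 1) * ε := by gcongr
      _ = y + ε := by field_simp
  refine ⟨j * Nat.fib (2 * k + 1), ?_, ?_⟩
  · have h1 : m₀ ≤ j := by
      have : (m₀ : ℝ) ≤ j := by
        have : (j : ℝ) * ε ≤ j := mul_le_of_le_one_right (by positivity) hε1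
        linarith
      exact_mod_cast this
    exact h1.trans (Nat.le_mul_of_pos_right _ (Nat.fib_pos.2 (by omega)))
  · have key : ∀ n : ℤ, n ∈ Finset.Icc (-(N : ℤ) - 1) (N + 1) →
        ⌊((n + (j * Nat.fib (2 * k + 1) : ℕ) : ℤ) : ℝ) * goldInv + ω⌋ =
          ⌊(n : ℝ) * goldInv + ω'⌋ + (j * Nat.fib (2 * k) + c : ℤ) := by
      intro n hn
      have h := hδn n hn
      have hf := Int.floor_add_fract ((n : ℝ) * goldInv + ω')
      have h0 := Int.fract_nonneg ((n : ℝ) * goldInv + ω')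
      have e : ((n + (j * Nat.fib (2 * k + 1) : ℕ) : ℤ) : ℝ) * goldInv + ω =
          (n * goldInv + ω') + (j * ε - y) + (j * Nat.fib (2 * k) + c) := by
        push_cast
        rw [hy]
        linear_combination (j : ℝ) * hfib
      rw [e, Int.floor_eq_iff]
      push_cast
      constructor <;> linarith
    intro n hn
    rw [abs_le] at hn
    have k1 := key n (by simp; omega)
    have k2 := key (n + 1) (by simp; omega)
    unfold sturmian
    rw [show n + ((j * Nat.fib (2 * k + 1) : ℕ) : ℤ) + 1 =
      n + 1 + ((j * Nat.fib (2 * k + 1) : ℕ) : ℤ) by ring, k1, k2]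
    ring

theorem sturmian_zero_reflect {n : ℤ} (hn : 1 ≤ n) : sturmian 0 (-1 - n) = sturmian 0 n := by
  have key : ∀ j : ℤ, 0 < j → ⌊((-j : ℤ) : ℝ) * goldInv⌋ = -⌊(j : ℝ) * goldInv⌋ - 1 := by
    intro j hj
    have h0 := Int.floor_le ((j : ℝ) * goldInv)
    have h1 := Int.lt_floor_add_one ((j : ℝ) * goldInv)
    have h2 : (⌊(j : ℝ) * goldInv⌋ : ℝ) < j * goldInv :=
      lt_of_le_of_ne h0 (int_mul_goldInv_ne hj.ne' _).symm
    rw [Int.floor_eq_iff]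
    push_cast
    constructor <;> linarith
  have k1 := key n (by omega)
  have k2 := key (n + 1) (by omega)
  simp only [sturmian, add_zero]
  rw [show -1 - n + 1 = -n by ring, show -1 - n = -(n + 1) by ring, k1, k2]
  ring

theorem sturmian_zero_add_fib (k : ℕ) {j : ℤ} (hj : 0 < j) (hjk : j + 1 < Nat.fib (k + 2)) :
    sturmian 0 (j + Nat.fib (k + 1)) = sturmian 0 j := by
  have k1 := floor_add_fib_mul_goldInv k hj (by omega)
  have k2 := floor_add_fib_mul_goldInv k (j := j + 1) (by omega) hjk
  simp only [sturmian, add_zero]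
  rw [show j + (Nat.fib (k + 1) : ℤ) + 1 = j + 1 + Nat.fib (k + 1) by ring, k1, k2]
  ring

theorem sturmian_zero_one : sturmian 0 1 = 1 := by
  have p0 := goldInv_pos
  have p1 := goldInv_lt_one
  have h := goldInv_sq
  have e1 : ⌊((1 + 1 : ℤ) : ℝ) * goldInv⌋ = 1 := by
    rw [Int.floor_eq_iff]; push_cast; constructor <;> nlinarith
  have e2 : ⌊((1 : ℤ) : ℝ) * goldInv⌋ = 0 := by
    rw [Int.floor_eq_iff]; push_cast; constructor <;> linarith
  simp only [sturmian, add_zero]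
  rw [e1, e2]; rfl

theorem sturmian_zero_two : sturmian 0 2 = 0 := by
  have p0 := goldInv_pos
  have p1 := goldInv_lt_one
  have h := goldInv_sq
  have e1 : ⌊((2 + 1 : ℤ) : ℝ) * goldInv⌋ = 1 := by
    rw [Int.floor_eq_iff]; push_cast; constructor <;> nlinarith
  have e2 : ⌊((2 : ℤ) : ℝ) * goldInv⌋ = 1 := by
    rw [Int.floor_eq_iff]; push_cast; constructor <;> nlinarith
  simp only [sturmian, add_zero]
  rw [e1, e2]; rfl

/-- The sequence of half-traces `x₋₁ = 1, x₀ = E / 2, x₁ = (E - V) / 2, …`, with index shifted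
by one. -/
def halfTrace (V E : ℝ) : ℕ → ℝ
  | 0 => 1
  | 1 => E / 2
  | 2 => (E - V) / 2
  | n + 3 => 2 * halfTrace V E (n + 2) * halfTrace V E (n + 1) - halfTrace V E n

theorem halfTrace_add_three (V E : ℝ) (n : ℕ) : halfTrace V E (n + 3) =
    2 * halfTrace V E (n + 2) * halfTrace V E (n + 1) - halfTrace V E n := by
  rw [halfTrace]

theorem traceMap_iterate (V E : ℝ) (n : ℕ) : traceMap^[n] ((E - V) / 2, E / 2, 1) =
    (halfTrace V E (n + 2), halfTrace V E (n + 1), halfTrace V E n) := by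
  induction n with
  | zero => simp [halfTrace]
  | succ n ih => rw [Function.iterate_succ_apply', ih, traceMap, ← halfTrace_add_three]

theorem bounded_orbit_iff (V E : ℝ) :
    (∃ M > 0, ∀ n : ℕ, ‖traceMap^[n] ((E - V) / 2, E / 2, 1)‖ ≤ M) ↔
      ∃ M, ∀ n, |halfTrace V E n| ≤ M := by
  simp only [traceMap_iterate, Prod.norm_def, Real.norm_eq_abs]
  constructor
  · rintro ⟨M, -, h⟩
    exact ⟨M, fun n => le_trans (le_trans (le_max_right _ _) (le_max_right _ _)) (h n)⟩
  · rintro ⟨M, h⟩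
    exact ⟨max M 1, by positivity, fun n => le_max_of_le_left
      (max_le (h _) (max_le (h _) (h _)))⟩

theorem halfTrace_invariant (V E : ℝ) (n : ℕ) :
    halfTrace V E (n + 2) ^ 2 + halfTrace V E (n + 1) ^ 2 + halfTrace V E n ^ 2 -
      2 * halfTrace V E (n + 2) * halfTrace V E (n + 1) * halfTrace V E n - 1 = V ^ 2 / 4 := by
  induction n with
  | zero => simp only [halfTrace]; ring
  | succ n ih =>
    rw [show n + 1 + 2 = n + 3 from rfl, halfTrace_add_three, show n + 1 + 1 = n + 2 from rfl]
    linear_combination ih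

/-- A condition on three consecutive half-traces that propagates along the recursion. -/
def Escaping (V E : ℝ) (n : ℕ) : Prop :=
  1 < |halfTrace V E (n + 1)| ∧ 1 < |halfTrace V E (n + 2)| ∧
    |halfTrace V E n| < |halfTrace V E (n + 1) * halfTrace V E (n + 2)|

theorem Escaping.succ {V E : ℝ} {n : ℕ} (h : Escaping V E n) : Escaping V E (n + 1) := by
  obtain ⟨h1, h2, h3⟩ := h
  have h4 : |halfTrace V E (n + 1)| * |halfTrace V E (n + 2)| < |halfTrace V E (n + 3)| := by
    rw [halfTrace_add_three]
    have := abs_sub_abs_le_abs_sub (2 * halfTrace V E (n + 2) * halfTrace V E (n + 1))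
      (halfTrace V E n)
    rw [abs_mul, abs_mul, abs_two] at this
    rw [abs_mul] at h3
    nlinarith
  refine ⟨h2, ?_, ?_⟩
  · exact lt_trans (by nlinarith) h4
  · rw [abs_mul]
    change |halfTrace V E (n + 1)| < |halfTrace V E (n + 2)| * |halfTrace V E (n + 3)|
    have h5 : |halfTrace V E (n + 1)| < |halfTrace V E (n + 3)| := by nlinarith
    nlinarith

theorem Escaping.mono {V E : ℝ} {n m : ℕ} (h : Escaping V E n) (hnm : n ≤ m) :
    Escaping V E m := by
  induction hnm with
  | refl => exact h
  | step _ ih => exact ih.succ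

theorem halfTrace_bounded_of_not_escaping {V E : ℝ} (h : ∀ n, ¬ Escaping V E n) :
    ∃ M, ∀ n, |halfTrace V E n| ≤ M := by
  have hpair : ∀ n, |halfTrace V E n| ≤ 1 ∨ |halfTrace V E (n + 1)| ≤ 1 := by
    intro n
    induction n with
    | zero => left; simp [halfTrace]
    | succ n ih =>
      by_contra! hc
      rcases ih with h1 | h1
      · refine h n ⟨hc.1, hc.2, lt_of_le_of_lt h1 ?_⟩
        rw [abs_mul]
        exact one_lt_mul_of_lt_of_le hc.1 hc.2.le
      · exact absurd h1 (not_le.2 hc.1)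
  refine ⟨max (2 + |V|) (max 1 |E / 2|), fun n => ?_⟩
  match n with
  | 0 => simp [halfTrace]
  | 1 => exact le_trans (by simp only [halfTrace]; exact le_max_right _ _) (le_max_right _ _)
  | n + 2 =>
    by_cases h2 : |halfTrace V E (n + 2)| ≤ 1
    · exact le_max_of_le_left (by linarith [abs_nonneg V])
    · apply le_max_of_le_left
      have a1 := (hpair (n + 1)).resolve_right h2
      have a3 := (hpair (n + 2)).resolve_left h2
      have inv := halfTrace_invariant V E (n + 1)
      change |halfTrace V E (n + 3)| ≤ 1 at a3
      change halfTrace V E (n + 3) ^ 2 + halfTrace V E (n + 2) ^ 2 + halfTrace V E (n + 1) ^ 2 -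
        2 * halfTrace V E (n + 3) * halfTrace V E (n + 2) * halfTrace V E (n + 1) - 1 =
          V ^ 2 / 4 at inv
      generalize halfTrace V E (n + 1) = x at *
      generalize halfTrace V E (n + 2) = y at *
      generalize halfTrace V E (n + 3) = z at *
      have hx : x ^ 2 ≤ 1 := (sq_le_one_iff_abs_le_one x).2 a1
      have hz : z ^ 2 ≤ 1 := (sq_le_one_iff_abs_le_one z).2 a3
      have e : (y - x * z) ^ 2 ≤ (1 + |V|) ^ 2 := by
        have := abs_nonneg V
        nlinarith [sq_abs V, mul_nonneg (sub_nonneg.2 hx) (sq_nonneg z), sq_nonneg x]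
      have e2 := abs_le_of_sq_le_sq e (by positivity)
      have e3 : |x * z| ≤ 1 := by
        rw [abs_mul]; exact mul_le_one₀ a1 (abs_nonneg _) a3
      rw [abs_le] at *
      constructor <;> linarith

theorem continuous_halfTrace (V : ℝ) (n : ℕ) : Continuous fun E => halfTrace V E n := by
  induction n using Nat.strong_induction_on with
  | _ n ih =>
    match n with
    | 0 => simp only [halfTrace]; fun_prop
    | 1 => simp only [halfTrace]; fun_prop
    | 2 => simp only [halfTrace]; fun_prop
    | n + 3 =>
      simp only [halfTrace_add_three]
      have h0 := ih n (by omega)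
      have h1 := ih (n + 1) (by omega)
      have h2 := ih (n + 2) (by omega)
      fun_prop

theorem isOpen_escaping (V : ℝ) (n : ℕ) : IsOpen {E | Escaping V E n} := by
  have h0 := continuous_halfTrace V n
  have h1 := continuous_halfTrace V (n + 1)
  have h2 := continuous_halfTrace V (n + 2)
  exact (isOpen_lt continuous_const h1.abs).inter ((isOpen_lt continuous_const h2.abs).inter
    (isOpen_lt h0.abs (h1.mul h2).abs))

/-- The one-step transfer matrix at a site where the sequence has the value `s`. -/
def stepMatrix (V E : ℝ) (s : ℤ) : Matrix (Fin 2) (Fin 2) ℝ := !![E - V * s, -1; 1, 0]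

/-- The transfer matrices over the Fibonacci words. -/
def fibMatrix (V E : ℝ) : ℕ → Matrix (Fin 2) (Fin 2) ℝ
  | 0 => stepMatrix V E 0
  | 1 => stepMatrix V E 1
  | n + 2 => fibMatrix V E n * fibMatrix V E (n + 1)

/-- The transfer matrix over the first `n` letters of the sequence with phase `0`. -/
def prefixMatrix (V E : ℝ) : ℕ → Matrix (Fin 2) (Fin 2) ℝ
  | 0 => 1
  | n + 1 => stepMatrix V E (sturmian 0 (n + 1)) * prefixMatrix V E n

theorem det_stepMatrix (V E : ℝ) (s : ℤ) : (stepMatrix V E s).det = 1 := by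
  simp [stepMatrix, Matrix.det_fin_two]

theorem det_fibMatrix (V E : ℝ) (n : ℕ) : (fibMatrix V E n).det = 1 := by
  induction n using Nat.twoStepInduction with
  | zero => exact det_stepMatrix ..
  | one => exact det_stepMatrix ..
  | more n h1 h2 => rw [fibMatrix, Matrix.det_mul, h1, h2, one_mul]

theorem trace_mul_mul_of_det_eq_one {P : Matrix (Fin 2) (Fin 2) ℝ} (Q : Matrix (Fin 2) (Fin 2) ℝ)
    (hP : P.det = 1) : (P * (Q * P)).trace = P.trace * (Q * P).trace - Q.trace := by
  rw [Matrix.det_fin_two] at hP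
  simp only [Matrix.trace_fin_two, Matrix.mul_apply, Fin.sum_univ_two]
  linear_combination (-(Q 0 0 + Q 1 1)) * hP

theorem trace_fibMatrix (V E : ℝ) (n : ℕ) :
    (fibMatrix V E n).trace = 2 * halfTrace V E (n + 1) := by
  induction n using Nat.strong_induction_on with
  | _ n ih =>
    match n with
    | 0 => simp [fibMatrix, stepMatrix, halfTrace, Matrix.trace_fin_two]; ring
    | 1 => simp [fibMatrix, stepMatrix, halfTrace, Matrix.trace_fin_two]; ring
    | 2 =>
      simp [fibMatrix, stepMatrix, halfTrace, Matrix.trace_fin_two]; ring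
    | n + 3 =>
      have h0 := ih n (by omega)
      have h1 := ih (n + 1) (by omega)
      have h2 := ih (n + 2) (by omega)
      rw [fibMatrix, fibMatrix, trace_mul_mul_of_det_eq_one _ (det_fibMatrix V E (n + 1)),
        ← fibMatrix, h0, h1, h2, halfTrace_add_three V E (n + 1)]
      ring

theorem prefixMatrix_add (V E : ℝ) (q l : ℕ)
    (h : ∀ j : ℕ, 1 ≤ j → j ≤ l → sturmian 0 (j + q) = sturmian 0 j) :
    prefixMatrix V E (q + l) = prefixMatrix V E l * prefixMatrix V E q := by
  induction l with
  | zero => simp [prefixMatrix]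
  | succ l ih =>
    have h1 := h (l + 1) (by omega) le_rfl
    rw [← add_assoc, prefixMatrix, prefixMatrix, ih fun j hj hjl => h j hj (by omega), mul_assoc]
    push_cast at h1 ⊢
    rw [← h1]
    congr 3
    ring

theorem prefixMatrix_fib (V E : ℝ) (k : ℕ) :
    prefixMatrix V E (Nat.fib (k + 2)) = fibMatrix V E (k + 1) := by
  induction k using Nat.twoStepInduction with
  | zero => simp [prefixMatrix, fibMatrix, sturmian_zero_one]
  | one =>
    have e : Nat.fib (1 + 2) = 2 := rfl
    have h := sturmian_zero_one
    have h' := sturmian_zero_two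
    rw [e]
    simp [prefixMatrix, fibMatrix, h, h', one_add_one_eq_two]
  | more n h1 h2 =>
    rw [show n + 2 + 2 = n + 2 + 1 + 1 from rfl, Nat.fib_add_two (n := n + 1 + 1), add_comm,
      prefixMatrix_add, h1, h2]
    · rfl
    · intro j hj hjl
      refine sturmian_zero_add_fib (n + 2) (by omega) ?_
      have a := Nat.fib_add_two (n := n + 2)
      have b : Nat.fib 3 ≤ Nat.fib (n + 3) := Nat.fib_mono (by omega)
      have c : Nat.fib 3 = 2 := rfl
      rw [show n + 2 + 1 = n + 3 from rfl] at a
      rw [show n + 1 + 1 = n + 2 from rfl] at hjl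
      omega

theorem prefixMatrix_two_mul_fib (V E : ℝ) (k : ℕ) :
    prefixMatrix V E (2 * Nat.fib (k + 4)) =
      prefixMatrix V E (Nat.fib (k + 4)) * prefixMatrix V E (Nat.fib (k + 4)) := by
  rw [two_mul, prefixMatrix_add]
  intro j hj hjl
  refine sturmian_zero_add_fib (k + 3) (by omega) ?_
  have a := Nat.fib_add_two (n := k + 3)
  have b : Nat.fib 3 ≤ Nat.fib (k + 3) := Nat.fib_mono (by omega)
  have c : Nat.fib 3 = 2 := rfl
  rw [show k + 3 + 1 = k + 4 from rfl] at a
  omega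

/-- Solutions are propagated by the transfer matrices. -/
theorem prefixMatrix_mulVec {V E : ℝ} {r : ℕ → ℝ} {N : ℕ}
    (hr : ∀ n < N, r (n + 2) + r n + V * sturmian 0 (n + 1) * r (n + 1) = E * r (n + 1))
    {n : ℕ} (hn : n ≤ N) :
    (prefixMatrix V E n).mulVec ![r 1, r 0] = ![r (n + 1), r n] := by
  induction n with
  | zero => simp [prefixMatrix]
  | succ n ih =>
    rw [prefixMatrix, ← Matrix.mulVec_mulVec, ih (by omega)]
    have := hr n (by omega)
    ext i
    fin_cases i
    · simp [stepMatrix]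
      linear_combination -this
    · simp [stepMatrix]

/-- Gordon's two-block estimate. -/
theorem gordon_two_block {V E C : ℝ} {k : ℕ} (hC : (2 * halfTrace V E (k + 4)) ^ 2 ≤ C)
    {r : ℕ → ℝ}
    (hr : ∀ n < 2 * Nat.fib (k + 4),
      r (n + 2) + r n + V * sturmian 0 (n + 1) * r (n + 1) = E * r (n + 1)) :
    r 0 ^ 2 + r 1 ^ 2 ≤ (C + 1) *
      (r (Nat.fib (k + 4)) ^ 2 + r (Nat.fib (k + 4) + 1) ^ 2 +
        (r (2 * Nat.fib (k + 4)) ^ 2 + r (2 * Nat.fib (k + 4) + 1) ^ 2)) := by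
  have h1 := prefixMatrix_mulVec hr (n := Nat.fib (k + 4)) (by omega)
  have h2 := prefixMatrix_mulVec hr (n := 2 * Nat.fib (k + 4)) le_rfl
  rw [prefixMatrix_two_mul_fib, ← Matrix.mulVec_mulVec, h1] at h2
  rw [prefixMatrix_fib V E (k + 2)] at h1 h2
  have hd := det_fibMatrix V E (k + 3)
  have ht := trace_fibMatrix V E (k + 3)
  change _ = 2 * halfTrace V E (k + 4) at ht
  change (fibMatrix V E (k + 3)).mulVec _ = _ at h1 h2
  rw [← ht] at hC
  generalize fibMatrix V E (k + 3) = P at *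
  rw [Matrix.det_fin_two] at hd
  rw [Matrix.trace_fin_two] at hC
  have a0 := congrFun h1 0
  have a1 := congrFun h1 1
  have b0 := congrFun h2 0
  have b1 := congrFun h2 1
  simp [Matrix.mulVec, dotProduct] at a0 a1 b0 b1
  generalize r 0 = r0 at *
  generalize r 1 = r1 at *
  generalize r (Nat.fib (k + 4)) = s0 at *
  generalize r (Nat.fib (k + 4) + 1) = s1 at *
  generalize r (2 * Nat.fib (k + 4)) = t0 at *
  generalize r (2 * Nat.fib (k + 4) + 1) = t1 at *
  set t := P 0 0 + P 1 1
  have c0 : r0 = t * s0 - t0 := by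
    rw [← b1, ← a0, ← a1]; linear_combination (-r0) * hd
  have c1 : r1 = t * s1 - t1 := by
    rw [← b0, ← a0, ← a1]; linear_combination (-r1) * hd
  have d0 : r0 ^ 2 ≤ (C + 1) * (s0 ^ 2 + t0 ^ 2) := by
    rw [c0]
    nlinarith [sq_nonneg (s0 + t * t0), mul_nonneg (sub_nonneg.2 hC) (sq_nonneg s0),
      mul_nonneg (sub_nonneg.2 hC) (sq_nonneg t0)]
  have d1 : r1 ^ 2 ≤ (C + 1) * (s1 ^ 2 + t1 ^ 2) := by
    rw [c1]
    nlinarith [sq_nonneg (s1 + t * t1), mul_nonneg (sub_nonneg.2 hC) (sq_nonneg s1),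
      mul_nonneg (sub_nonneg.2 hC) (sq_nonneg t1)]
  linarith

/-- If every eigenvalue of a symmetric operator has distance at least `d` from `e`, the operator
`T - e` is bounded below by `d`. -/
theorem LinearMap.IsSymmetric.mul_norm_le_norm_sub_smul {F : Type*} [NormedAddCommGroup F]
    [InnerProductSpace ℝ F] [FiniteDimensional ℝ F] {T : F →ₗ[ℝ] F} (hT : T.IsSymmetric)
    {e d : ℝ} (hd : 0 ≤ d) (h : ∀ μ : ℝ, Module.End.HasEigenvalue T μ → d ≤ |μ - e|) (v : F) :
    d * ‖v‖ ≤ ‖T v - e • v‖ := by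
  set b := hT.eigenvectorBasis rfl
  rw [← b.repr.norm_map v, ← b.repr.norm_map (T v - e • v)]
  refine (sq_le_sq₀ (by positivity) (norm_nonneg _)).1 ?_
  rw [mul_pow, EuclideanSpace.norm_sq_eq, EuclideanSpace.norm_sq_eq, Finset.mul_sum]
  refine Finset.sum_le_sum fun i _ => ?_
  have hi : b.repr (T v - e • v) i = (hT.eigenvalues rfl i - e) * b.repr v i := by
    rw [map_sub, map_smul]
    simp only [PiLp.sub_apply, PiLp.smul_apply, smul_eq_mul]
    rw [hT.eigenvectorBasis_apply_self_apply rfl v i]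
    simp only [RCLike.ofReal_real_eq_id, id_eq]
    ring
  rw [hi, norm_mul, mul_pow, Real.norm_eq_abs (_ - e)]
  have := h _ (hT.hasEigenvalue_eigenvalues rfl i)
  gcongr
  exact this

/-- The periodic approximant of the Fibonacci Hamiltonian with period `q`, restricted to
`q`-periodic sequences. -/
def cyclicHamiltonian (V : ℝ) (q : ℕ) [NeZero q] :
    EuclideanSpace ℝ (ZMod q) →ₗ[ℝ] EuclideanSpace ℝ (ZMod q) where
  toFun w := WithLp.toLp 2 fun j => w (j + 1) + w (j - 1) + V * sturmian 0 (j.val + 1) * w j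
  map_add' w z := by ext j; simp; ring
  map_smul' c w := by ext j; simp; ring

theorem cyclicHamiltonian_apply (V : ℝ) (q : ℕ) [NeZero q] (w : EuclideanSpace ℝ (ZMod q))
    (j : ZMod q) : cyclicHamiltonian V q w j =
      w (j + 1) + w (j - 1) + V * sturmian 0 (j.val + 1) * w j := rfl

theorem cyclicHamiltonian_isSymmetric (V : ℝ) (q : ℕ) [NeZero q] :
    (cyclicHamiltonian V q).IsSymmetric := by
  intro w z
  simp only [PiLp.inner_apply, cyclicHamiltonian_apply, RCLike.inner_apply, conj_trivial, mul_add,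
    add_mul, Finset.sum_add_distrib]
  have h1 := Fintype.sum_equiv (Equiv.addRight (1 : ZMod q)) (fun j => z j * w (j + 1))
    (fun j => z (j - 1) * w j) fun j => by simp
  have h2 := Fintype.sum_equiv (Equiv.addRight (1 : ZMod q)) (fun j => z (j + 1) * w j)
    (fun j => z j * w (j - 1)) fun j => by simp
  rw [h1, h2, add_comm (∑ j, z (j - 1) * w j)]
  congr 1
  exact Finset.sum_congr rfl fun j _ => by ring

/-- The monodromy matrix at an eigenvalue of the periodic approximant has the eigenvalue `1`. -/
theorem halfTrace_eq_one_of_hasEigenvalue {V E : ℝ} {q k : ℕ} [NeZero q]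
    (hqk : q = Nat.fib (k + 2)) (h : Module.End.HasEigenvalue (cyclicHamiltonian V q) E) :
    halfTrace V E (k + 2) = 1 := by
  obtain ⟨w, hw⟩ := h.exists_hasEigenvector
  have hw0 := hw.2
  replace hw := hw.apply_eq_smul
  set r : ℕ → ℝ := fun n => w ((n : ZMod q) - 1) with hr
  have heq : ∀ n < q, r (n + 2) + r n + V * sturmian 0 (n + 1) * r (n + 1) = E * r (n + 1) := by
    intro n hn
    have := congrArg (fun z : EuclideanSpace ℝ (ZMod q) => z (n : ZMod q)) hw
    simp only [cyclicHamiltonian_apply, PiLp.smul_apply, smul_eq_mul, ZMod.val_cast_of_lt hn]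
      at this
    simp only [hr, Nat.cast_add, Nat.cast_one, Nat.cast_ofNat, add_sub_cancel_right]
    rw [← this, show (n : ZMod q) + 2 - 1 = n + 1 by ring]
  have hne : r 0 ≠ 0 ∨ r 1 ≠ 0 := by
    by_contra! hc
    apply hw0
    ext j
    have hz := prefixMatrix_mulVec heq (ZMod.val_lt j).le
    rw [hc.1, hc.2] at hz
    have := congrFun hz 0
    simpa [Matrix.mulVec, dotProduct, hr] using this.symm
  have hq := prefixMatrix_mulVec heq le_rfl
  rw [show prefixMatrix V E q = _ from hqk ▸ prefixMatrix_fib V E k] at hq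
  have e0 : r q = r 0 := by simp [hr]
  have e1 : r (q + 1) = r 1 := by simp [hr]
  rw [e0, e1] at hq
  have hd := det_fibMatrix V E (k + 1)
  have ht := trace_fibMatrix V E (k + 1)
  rw [Matrix.det_fin_two] at hd
  rw [Matrix.trace_fin_two] at ht
  generalize fibMatrix V E (k + 1) = P at *
  have a0 := congrFun hq 0
  have a1 := congrFun hq 1
  simp [Matrix.mulVec, dotProduct] at a0 a1
  have : P 0 0 + P 1 1 = 2 := by
    rcases hne with h0 | h0
    · apply mul_right_cancel₀ h0
      linear_combination r 0 * hd + P 1 0 * a0 + (1 - P 0 0) * a1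
    · apply mul_right_cancel₀ h0
      linear_combination r 1 * hd + P 0 1 * a1 + (1 - P 1 1) * a0
  change _ = 2 * halfTrace V E (k + 2) at ht
  linarith

theorem sum_zmod_val_eq_sum_Icc (q : ℕ) [NeZero q] (m : ℤ) (F : ℤ → ℝ) :
    ∑ j : ZMod q, F (j.val + 1 - m) = ∑ n ∈ Finset.Icc (1 - m) (q - m), F n := by
  refine Finset.sum_bij (fun j _ => (j.val : ℤ) + 1 - m) ?_ ?_ ?_ ?_
  · intro j _
    have := ZMod.val_lt j
    rw [Finset.mem_Icc]
    omega
  · intro a _ b _ h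
    exact ZMod.val_injective q (by omega)
  · intro n hn
    rw [Finset.mem_Icc] at hn
    refine ⟨((n - 1 + m).toNat : ZMod q), Finset.mem_univ _, ?_⟩
    rw [ZMod.val_cast_of_lt (by omega)]
    omega
  · intro j _; rfl

/-- If the half-traces escape uniformly near `E`, the Fibonacci Hamiltonian minus `E` is bounded
below on finitely supported sequences. -/
theorem sum_sq_le_of_escaping {V E d : ℝ} (hd : 0 ≤ d) {k₀ : ℕ}
    (hesc : ∀ E', |E' - E| < d → Escaping V E' k₀) (ω : ℝ) {f : ℤ → ℝ} {L : ℕ}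
    (hf : ∀ n : ℤ, L < |n| → f n = 0) :
    d ^ 2 * ∑ n ∈ Finset.Icc (-(L : ℤ)) L, f n ^ 2 ≤
      ∑ n ∈ Finset.Icc (-(L : ℤ) - 1) (L + 1),
        (f (n + 1) + f (n - 1) + V * sturmian ω n * f n - E * f n) ^ 2 := by
  obtain ⟨m, hm, hmw⟩ := exists_sturmian_window 0 ω L (L + 2)
  set k := k₀ + (m + L + 10) with hk
  have hkq : m + L + 2 ≤ Nat.fib (k + 2) := by
    have := Nat.le_fib_self (n := k + 2) (by omega)
    omega
  set q := Nat.fib (k + 2)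
  have : NeZero q := ⟨by omega⟩
  have hev : ∀ μ : ℝ, Module.End.HasEigenvalue (cyclicHamiltonian V q) μ → d ≤ |μ - E| := by
    intro μ hμ
    by_contra! hc
    have h1 := ((hesc μ hc).mono (show k₀ ≤ k by omega)).2.1
    rw [halfTrace_eq_one_of_hasEigenvalue (k := k) rfl hμ] at h1
    simp at h1
  set w : EuclideanSpace ℝ (ZMod q) := WithLp.toLp 2 fun j => f (j.val + 1 - m) with hw
  have hT : ∀ j, (cyclicHamiltonian V q w - E • w) j =
      (fun n => f (n + 1) + f (n - 1) + V * sturmian ω n * f n - E * f n) (j.val + 1 - m) := by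
    intro j
    have hj := ZMod.val_lt j
    have e1 : w (j + 1) = f (j.val + 1 - m + 1) := by
      simp only [hw]
      have hj' : j + 1 = ((j.val + 1 : ℕ) : ZMod q) := by simp
      rw [hj']
      rcases Nat.lt_or_ge (j.val + 1) q with h | h
      · rw [ZMod.val_cast_of_lt h]; push_cast; congr 1; ring
      · rw [show j.val + 1 = q by omega, ZMod.natCast_self, ZMod.val_zero, hf _ (by rw [lt_abs]; omega), hf _ (by rw [lt_abs]; omega)]
    have e2 : w (j - 1) = f (j.val + 1 - m - 1) := by
      simp only [hw]
      rcases Nat.eq_zero_or_pos j.val with h | h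
      · rw [hf (_ + 1 - (m : ℤ) - 1) (by rw [lt_abs]; omega)]
        have hj' : j - 1 = ((q - 1 : ℕ) : ZMod q) := by
          rw [(ZMod.val_eq_zero j).1 h, Nat.cast_sub (by omega)]; simp
        rw [hj', ZMod.val_cast_of_lt (by omega)]
        exact hf _ (by rw [lt_abs]; omega)
      · have hj' : j - 1 = ((j.val - 1 : ℕ) : ZMod q) := by
          rw [Nat.cast_sub h]; simp
        rw [hj', ZMod.val_cast_of_lt (by omega)]
        congr 1
        omega
    simp only [PiLp.sub_apply, PiLp.smul_apply, smul_eq_mul, cyclicHamiltonian_apply]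
    rw [e1, e2]
    change _ + V * _ * f (j.val + 1 - m) - E * f (j.val + 1 - m) = _
    by_cases h : |(j.val : ℤ) + 1 - m| ≤ L
    · rw [← hmw _ h, sub_add_cancel]
    · rw [hf ((j.val : ℤ) + 1 - m) (not_le.1 h)]
      simp
  have key := (cyclicHamiltonian_isSymmetric V q).mul_norm_le_norm_sub_smul hd hev w
  have key2 := pow_le_pow_left₀ (by positivity) key 2
  rw [mul_pow, EuclideanSpace.norm_sq_eq, EuclideanSpace.norm_sq_eq] at key2
  simp only [Real.norm_eq_abs, sq_abs] at key2
  simp only [hT] at key2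
  have s1 := sum_zmod_val_eq_sum_Icc q m fun n => f n ^ 2
  have s2 := sum_zmod_val_eq_sum_Icc q m fun n =>
    (f (n + 1) + f (n - 1) + V * sturmian ω n * f n - E * f n) ^ 2
  rw [s2] at key2
  change d ^ 2 * ∑ j : ZMod q, f (j.val + 1 - m) ^ 2 ≤ _ at key2
  rw [s1] at key2
  have t1 : ∑ n ∈ Finset.Icc (-(L : ℤ)) L, f n ^ 2 =
      ∑ n ∈ Finset.Icc (1 - (m : ℤ)) (q - m), f n ^ 2 := by
    refine Finset.sum_subset (Finset.Icc_subset_Icc (by omega) (by omega)) fun n _ hn => ?_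
    rw [Finset.mem_Icc] at hn
    rw [hf n (by rw [lt_abs]; omega)]
    simp
  refine le_trans (le_of_eq (by rw [t1])) (key2.trans (le_of_eq ?_))
  · symm
    refine Finset.sum_subset (Finset.Icc_subset_Icc (by omega) (by omega)) fun n _ hn => ?_
    rw [Finset.mem_Icc] at hn
    rw [hf n (by rw [lt_abs]; omega), hf (n + 1) (by rw [lt_abs]; omega),
      hf (n - 1) (by rw [lt_abs]; omega)]
    simp

/-- Under a bound on the traces, solutions on a half-line have large `ℓ²`-mass. -/
theorem mul_le_sum_sq_of_bounded_trace {V E C : ℝ} (hC : ∀ n, (2 * halfTrace V E n) ^ 2 ≤ C)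
    {r : ℕ → ℝ} (K : ℕ)
    (hr : ∀ n < 2 * Nat.fib (3 * K + 4),
      r (n + 2) + r n + V * sturmian 0 (n + 1) * r (n + 1) = E * r (n + 1)) :
    K * (r 0 ^ 2 + r 1 ^ 2) ≤
      (C + 1) * ∑ n ∈ Finset.range (Nat.fib (3 * K + 4)), r n ^ 2 := by
  have hC0 : 0 ≤ C := le_trans (sq_nonneg _) (hC 0)
  induction K with
  | zero => simp; positivity
  | succ K ih =>
    set a := Nat.fib (3 * K + 4) with ha
    set b := Nat.fib (3 * (K + 1) + 4) with hb
    have hab : 2 * a + 2 ≤ b := by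
      have e1 := Nat.fib_add_two (n := 3 * K + 5)
      have e2 := Nat.fib_add_two (n := 3 * K + 4)
      have e3 : Nat.fib 4 ≤ Nat.fib (3 * K + 4) := Nat.fib_mono (by omega)
      have e4 : Nat.fib 4 ≤ Nat.fib (3 * K + 5) := Nat.fib_mono (by omega)
      have e5 : Nat.fib 4 = 3 := rfl
      have e6 : Nat.fib (3 * K + 4) ≤ Nat.fib (3 * K + 5) := Nat.fib_mono (by omega)
      rw [show 3 * K + 5 + 2 = 3 * (K + 1) + 4 by ring, show 3 * K + 5 + 1 = 3 * K + 6 by ring]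
        at e1
      rw [show 3 * K + 4 + 2 = 3 * K + 6 by ring, show 3 * K + 4 + 1 = 3 * K + 5 by ring] at e2
      omega
    have ha2 : 3 ≤ a := le_trans (show 3 ≤ Nat.fib 4 from le_rfl) (Nat.fib_mono (by omega))
    have ih' := ih fun n hn => hr n (by omega)
    have hg := gordon_two_block (k := 3 * K) (hC _) fun n hn => hr n (by omega)
    rw [← ha] at hg
    have hsum : r a ^ 2 + r (a + 1) ^ 2 + (r (2 * a) ^ 2 + r (2 * a + 1) ^ 2) ≤
        ∑ n ∈ Finset.Ico a b, r n ^ 2 := by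
      have hs : ({a, a + 1, 2 * a, 2 * a + 1} : Finset ℕ) ⊆ Finset.Ico a b := by
        intro x hx
        simp only [Finset.mem_insert, Finset.mem_singleton] at hx
        rw [Finset.mem_Ico]
        omega
      refine le_trans (le_of_eq ?_) (Finset.sum_le_sum_of_subset_of_nonneg hs
        fun _ _ _ => sq_nonneg _)
      rw [Finset.sum_insert (by simp; omega), Finset.sum_insert (by simp; omega),
        Finset.sum_insert (by simp), Finset.sum_singleton]
      ring
    rw [← Finset.sum_range_add_sum_Ico _ (show a ≤ b by omega), mul_add]
    push_cast
    have : (C + 1) * (r a ^ 2 + r (a + 1) ^ 2 + (r (2 * a) ^ 2 + r (2 * a + 1) ^ 2)) ≤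
        (C + 1) * ∑ n ∈ Finset.Ico a b, r n ^ 2 := by gcongr
    linarith

theorem lp_sum_sq_le (u : lp (fun _ : ℤ => ℂ) 2) (s : Finset ℤ) :
    ∑ n ∈ s, ‖u n‖ ^ 2 ≤ ‖u‖ ^ 2 := by
  have := lp.sum_rpow_le_norm_rpow (p := 2) (by simp) u s
  simpa using this

theorem lp_norm_sq_of_support {u : lp (fun _ : ℤ => ℂ) 2} {s : Finset ℤ}
    (h : ∀ n ∉ s, u n = 0) : ‖u‖ ^ 2 = ∑ n ∈ s, ‖u n‖ ^ 2 := by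
  have := lp.norm_rpow_eq_tsum (p := 2) (by simp) u
  rw [tsum_eq_sum (s := s) fun n hn => by simp [h n hn]] at this
  simpa using this

/-- `H` is the Fibonacci Hamiltonian with coupling constant `V` and phase `ω`. -/
def IsFibonacciHamiltonian (V ω : ℝ) (H : lp (fun _ : ℤ => ℂ) 2 →L[ℂ] lp (fun _ : ℤ => ℂ) 2) :
    Prop :=
  ∀ (u : lp (fun _ : ℤ => ℂ) 2) (n : ℤ),
    (H u) n = u (n + 1) + u (n - 1) + (V : ℂ) * (sturmian ω n : ℂ) * u n

namespace IsFibonacciHamiltonian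

variable {V ω : ℝ} {H : lp (fun _ : ℤ => ℂ) 2 →L[ℂ] lp (fun _ : ℤ => ℂ) 2}

theorem apply_single (hH : IsFibonacciHamiltonian V ω H) (n : ℤ) :
    H (lp.single 2 n 1) = lp.single 2 (n - 1) 1 + lp.single 2 (n + 1) 1 +
      lp.single 2 n ((V : ℂ) * (sturmian ω n : ℂ)) := by
  ext m
  rw [hH]
  simp only [lp.coeFn_add, Pi.add_apply, lp.single_apply, Pi.single_apply]
  congr 1
  · congr 1
    · simp only [eq_sub_iff_add_eq]
    · simp only [sub_eq_iff_eq_add]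
  · by_cases h : m = n
    · simp [h]
    · simp [h]

theorem notMem_spectrum_of_bound (hH : IsFibonacciHamiltonian V ω H) {E d : ℝ} (hd : 0 < d)
    (h : ∀ u, d * ‖u‖ ≤ ‖H u - (E : ℂ) • u‖) : (E : ℂ) ∉ spectrum ℂ H := by
  rw [spectrum.notMem_iff, ContinuousLinearMap.isUnit_iff_bijective,
    ContinuousLinearMap.bijective_iff_dense_range_and_antilipschitz]
  have hS : ∀ u, (algebraMap ℂ (lp (fun _ : ℤ => ℂ) 2 →L[ℂ] lp (fun _ : ℤ => ℂ) 2) (E : ℂ) - H) u =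
      (E : ℂ) • u - H u := fun u => by
    rw [sub_apply, ContinuousLinearMap.algebraMap_apply]
  constructor
  · rw [Submodule.topologicalClosure_eq_top_iff, Submodule.eq_bot_iff]
    intro w hw
    have hker : H w - (E : ℂ) • w = 0 := by
      ext n
      have := hw _ ⟨lp.single 2 n 1, hS _⟩
      rw [hH.apply_single, inner_sub_left, inner_smul_left, inner_add_left, inner_add_left] at this
      simp only [lp.inner_single_left, RCLike.inner_apply, map_one, mul_one, map_mul,
        Complex.conj_ofReal, map_intCast] at this
      simp only [lp.coeFn_sub, lp.coeFn_smul, Pi.sub_apply, Pi.smul_apply, smul_eq_mul, hH w n,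
        lp.coeFn_zero, Pi.zero_apply]
      linear_combination -this
    have := h w
    rw [hker, norm_zero] at this
    have h0 : ‖w‖ ≤ 0 := nonpos_of_mul_nonpos_right this hd
    exact norm_le_zero_iff.1 h0
  · refine ⟨⟨d⁻¹, by positivity⟩, ContinuousLinearMap.antilipschitz_of_bound _ fun u => ?_⟩
    rw [hS, norm_sub_rev]
    change ‖u‖ ≤ d⁻¹ * _
    rw [inv_mul_eq_div, le_div_iff₀ hd, mul_comm]
    exact h u

theorem bound_of_escaping (hH : IsFibonacciHamiltonian V ω H) {E d : ℝ} (hd : 0 ≤ d) {k₀ : ℕ}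
    (hesc : ∀ E', |E' - E| < d → Escaping V E' k₀) (u : lp (fun _ : ℤ => ℂ) 2) :
    d * ‖u‖ ≤ ‖H u - (E : ℂ) • u‖ := by
  set φ : ℕ → lp (fun _ : ℤ => ℂ) 2 := fun L =>
    ∑ i ∈ Finset.Icc (-(L : ℤ)) L, lp.single 2 i (u i) with hφ
  have hφu : Filter.Tendsto φ Filter.atTop (nhds u) := by
    have h1 : Filter.Tendsto (fun s : Finset ℤ => ∑ i ∈ s, lp.single 2 i (u i)) Filter.atTop
        (nhds u) := lp.hasSum_single (by simp) u
    refine h1.comp (Filter.tendsto_atTop_finset_of_monotone ?_ ?_)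
    · intro a b hab
      exact Finset.Icc_subset_Icc (by simpa using hab) (by simpa using hab)
    · intro n
      exact ⟨n.natAbs, by rw [Finset.mem_Icc]; omega⟩
  refine le_of_tendsto_of_tendsto' ((hφu.norm).const_mul d)
    (((H.continuous.tendsto u).comp hφu).sub (hφu.const_smul (E : ℂ))).norm fun L => ?_
  change d * ‖φ L‖ ≤ ‖H (φ L) - (E : ℂ) • φ L‖
  have hsupp : ∀ n : ℤ, L < |n| → φ L n = 0 := by
    intro n hn
    simp only [hφ, lp.coeFn_sum, Finset.sum_apply, lp.single_apply]
    refine Finset.sum_eq_zero fun i hi => ?_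
    rw [Finset.mem_Icc] at hi
    rw [Pi.single_eq_of_ne]
    rintro rfl
    rw [lt_abs] at hn
    omega
  generalize φ L = v at *
  refine (sq_le_sq₀ (by positivity) (norm_nonneg _)).1 ?_
  rw [mul_pow, lp_norm_sq_of_support (s := Finset.Icc (-(L : ℤ)) L) fun n hn => hsupp n (by
    rw [Finset.mem_Icc] at hn; rw [lt_abs]; omega)]
  refine le_trans ?_ (lp_sum_sq_le _ (Finset.Icc (-(L : ℤ) - 1) (L + 1)))
  have hre := sum_sq_le_of_escaping hd hesc ω (f := fun n => (v n).re) (L := L)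
    fun n hn => by simp [hsupp n hn]
  have him := sum_sq_le_of_escaping hd hesc ω (f := fun n => (v n).im) (L := L)
    fun n hn => by simp [hsupp n hn]
  have hsq : ∀ z : ℂ, ‖z‖ ^ 2 = z.re ^ 2 + z.im ^ 2 := fun z => by
    rw [Complex.sq_norm, Complex.normSq_apply]; ring
  simp only [hsq, Finset.sum_add_distrib, mul_add]
  simp only [lp.coeFn_sub, lp.coeFn_smul, Pi.sub_apply, Pi.smul_apply, smul_eq_mul, hH v]
  refine (add_le_add hre him).trans (le_of_eq ?_)
  congr 1 <;> refine Finset.sum_congr rfl fun n _ => ?_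
  · simp
  · simp

theorem exists_sum_sq_bound (hH : IsFibonacciHamiltonian V ω H) {E : ℝ}
    (hE : (E : ℂ) ∉ spectrum ℂ H) : ∃ B : ℝ, ∀ N : ℕ, ∃ r : ℤ → ℝ,
      (∀ s : Finset ℤ, ∑ n ∈ s, r n ^ 2 ≤ B) ∧ ∀ n : ℤ, |n| ≤ N →
        E * r n - (r (n + 1) + r (n - 1) + V * sturmian 0 n * r n) = if n = 0 then 1 else 0 := by
  rw [spectrum.notMem_iff] at hE
  obtain ⟨S, hS⟩ := hE
  refine ⟨‖(↑S⁻¹ : lp (fun _ : ℤ => ℂ) 2 →L[ℂ] lp (fun _ : ℤ => ℂ) 2)‖ ^ 2, fun N => ?_⟩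
  obtain ⟨m, -, hm⟩ := exists_sturmian_window ω 0 N 0
  set R := (↑S⁻¹ : lp (fun _ : ℤ => ℂ) 2 →L[ℂ] lp (fun _ : ℤ => ℂ) 2)
  set u := R (lp.single 2 (m : ℤ) 1) with hu
  have hun : ‖u‖ ≤ ‖R‖ := by
    refine (R.le_opNorm _).trans (le_of_eq ?_)
    rw [lp.norm_single (by simp)]
    simp
  have hSu : (E : ℂ) • u - H u = lp.single 2 (m : ℤ) 1 := by
    have h1 : (S : lp (fun _ : ℤ => ℂ) 2 →L[ℂ] lp (fun _ : ℤ => ℂ) 2) u = lp.single 2 (m : ℤ) 1 := by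
      rw [hu, ← mul_apply_eq_comp, S.mul_inv]
      rfl
    rw [← h1, hS, sub_apply, ContinuousLinearMap.algebraMap_apply]
  refine ⟨fun n => (u (n + m)).re, fun s => ?_, fun n hn => ?_⟩
  · have h1 := lp_sum_sq_le u (s.map (addRightEmbedding (m : ℤ)))
    rw [Finset.sum_map] at h1
    refine le_trans (Finset.sum_le_sum fun n _ => ?_)
      (h1.trans (pow_le_pow_left₀ (norm_nonneg _) hun 2))
    rw [sq_le_sq, abs_norm]
    exact Complex.abs_re_le_norm _
  · have h1 := congrArg (fun v : lp (fun _ : ℤ => ℂ) 2 => (v (n + m)).re) hSu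
    simp only [lp.coeFn_sub, lp.coeFn_smul, Pi.sub_apply, Pi.smul_apply, smul_eq_mul, hH u,
      lp.single_apply, Pi.single_apply, hm n hn, add_eq_right] at h1
    rw [apply_ite Complex.re] at h1
    simp only [Complex.one_re, Complex.zero_re] at h1
    rw [← h1]
    beta_reduce
    rw [add_right_comm n 1, sub_add_eq_add_sub n 1]
    simp

theorem mem_spectrum_of_bounded (hH : IsFibonacciHamiltonian V ω H) {E M : ℝ}
    (hM : ∀ n, |halfTrace V E n| ≤ M) : (E : ℂ) ∈ spectrum ℂ H := by
  by_contra hE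
  obtain ⟨B, hB⟩ := hH.exists_sum_sq_bound hE
  set C := (2 * M) ^ 2 with hC
  have hCb : ∀ n, (2 * halfTrace V E n) ^ 2 ≤ C := by
    intro n
    rw [hC, sq_le_sq, abs_mul, abs_mul]
    exact mul_le_mul_of_nonneg_left ((hM n).trans (le_abs_self M)) (abs_nonneg 2)
  obtain ⟨K, hK⟩ := exists_nat_gt (2 * (E ^ 2 + 2) * ((C + 1) * B))
  obtain ⟨r, hrB, hr⟩ := hB (2 * Nat.fib (3 * K + 4) + 2)
  have hright := mul_le_sum_sq_of_bounded_trace hCb K (r := fun n => r n) (by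
    intro n hn
    have := hr (n + 1) (by rw [abs_le]; push_cast; omega)
    rw [if_neg (by omega), add_sub_cancel_right, add_assoc (n : ℤ)] at this
    push_cast
    rw [one_add_one_eq_two] at this
    linarith)
  have hleft := mul_le_sum_sq_of_bounded_trace hCb K (r := fun n => r (-1 - n)) (by
    intro n hn
    have := hr (-1 - (n + 1)) (by rw [abs_le]; push_cast; omega)
    rw [if_neg (by omega), sturmian_zero_reflect (by omega)] at this
    push_cast
    rw [show -1 - ((n : ℤ) + 1) + 1 = -1 - n by ring,
      show -1 - ((n : ℤ) + 1) - 1 = -1 - (n + 2) by ring] at this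
    linarith)
  have hB1 := hrB ((Finset.range (Nat.fib (3 * K + 4))).map Nat.castEmbedding)
  have hB2 := hrB ((Finset.range (Nat.fib (3 * K + 4))).map
    (Nat.castEmbedding.trans (Equiv.subLeft (-1 : ℤ)).toEmbedding))
  rw [Finset.sum_map] at hB1 hB2
  change ∑ n ∈ Finset.range (Nat.fib (3 * K + 4)), r n ^ 2 ≤ B at hB1
  change ∑ n ∈ Finset.range (Nat.fib (3 * K + 4)), r (-1 - n) ^ 2 ≤ B at hB2
  have hC1 : 0 < C + 1 := by positivity
  replace hright := hright.trans (mul_le_mul_of_nonneg_left hB1 hC1.le)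
  replace hleft := hleft.trans (mul_le_mul_of_nonneg_left hB2 hC1.le)
  have h0 := hr 0 (by simp; positivity)
  have hs0 : sturmian 0 0 = 0 := by
    have p0 := goldInv_pos
    have p1 := goldInv_lt_one
    have : ⌊goldInv⌋ = 0 := by rw [Int.floor_eq_iff]; constructor <;> simp <;> linarith
    simp [sturmian, this]
  rw [hs0] at h0
  simp only [Nat.cast_zero, Nat.cast_one, sub_zero] at hright hleft
  simp at h0 hright hleft
  generalize r 0 = a at *
  generalize r 1 = b at *
  generalize r (-1) = c at *
  generalize r (-2) = e at *
  have hcs : 1 ≤ (E ^ 2 + 2) * (a ^ 2 + b ^ 2 + c ^ 2) := by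
    have : 1 = (E * a - (b + c)) ^ 2 := by rw [h0]; norm_num
    rw [this]
    nlinarith [sq_nonneg (a + E * b), sq_nonneg (a + E * c), sq_nonneg (b - c)]
  have hK0 : (0 : ℝ) ≤ K := by positivity
  have : (K : ℝ) * 1 ≤ K * ((E ^ 2 + 2) * (a ^ 2 + b ^ 2 + c ^ 2)) := by gcongr
  have hsum : (K : ℝ) * (a ^ 2 + b ^ 2 + c ^ 2) ≤ 2 * ((C + 1) * B) := by
    nlinarith [mul_nonneg hK0 (sq_nonneg e)]
  have hE2 : 0 ≤ E ^ 2 + 2 := by positivity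
  nlinarith [mul_le_mul_of_nonneg_left hsum hE2]

theorem mem_spectrum_iff (hH : IsFibonacciHamiltonian V ω H) (E : ℝ) :
    (E : ℂ) ∈ spectrum ℂ H ↔ ∃ M, ∀ n, |halfTrace V E n| ≤ M := by
  refine ⟨fun hE => ?_, fun ⟨M, hM⟩ => hH.mem_spectrum_of_bounded hM⟩
  refine halfTrace_bounded_of_not_escaping fun k hk => ?_
  obtain ⟨d, hd, hball⟩ := Metric.isOpen_iff.1 (isOpen_escaping V k) E hk
  exact hH.notMem_spectrum_of_bound hd (hH.bound_of_escaping hd.le fun E' hE' => hball (by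
    rwa [Metric.mem_ball, Real.dist_eq])) hE

end IsFibonacciHamiltonian

/-- Sütő's theorem: `E` belongs to the spectrum of the Fibonacci Hamiltonian `H_{V,ω}` if and
only if the positive semiorbit of `((E-V)/2, E/2, 1)` under the trace map is bounded. -/
theorem suto_spectrum_iff_bounded_orbit (V ω : ℝ) (hV : 0 < V) (hω : ω ∈ Set.Ico (0 : ℝ) 1)
    (α : ℝ) (hα : α = (Real.sqrt 5 - 1) / 2)
    (H : lp (fun _ : ℤ => ℂ) 2 →L[ℂ] lp (fun _ : ℤ => ℂ) 2)
    (hH : ∀ (u : lp (fun _ : ℤ => ℂ) 2) (n : ℤ),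
      (H u) n = u (n + 1) + u (n - 1) +
        (V : ℂ) * (if Int.fract ((n : ℝ) * α + ω) ∈ Set.Ico (1 - α) 1 then (1:ℂ) else 0) * u n)
    (E : ℝ) :
    (E : ℂ) ∈ spectrum ℂ H ↔
      ∃ M > 0, ∀ n : ℕ, ‖traceMap^[n] ((E - V) / 2, E / 2, 1)‖ ≤ M := by
  subst hα
  rw [bounded_orbit_iff]
  refine IsFibonacciHamiltonian.mem_spectrum_iff (ω := ω) (fun u n => ?_) E
  rw [hH, ← ite_fract_eq_sturmian]
  rfl
end
end

section
/- The trace map restricted to the Cayley cubic is a factor of the hyperbolic torus automorphism 𝒜(θ,φ) = (θ + φ, θ): for all θ, φ ∈ ℝ, T(F(θ,φ)) = F(θ + φ, θ), where F(θ,φ) = (cos 2π(θ+φ), cos 2πθ, cos 2πφ). -/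
noncomputable section

/-- The semiconjugacy `F(θ,φ) = (cos 2π(θ+φ), cos 2πθ, cos 2πφ)`. -/
def semiConj : ℝ × ℝ → ℝ × ℝ × ℝ := fun q =>
  (Real.cos (2 * Real.pi * (q.1 + q.2)), Real.cos (2 * Real.pi * q.1),
    Real.cos (2 * Real.pi * q.2))

/-- The trace map on the Cayley cubic is a factor of the torus automorphism
`𝒜(θ,φ) = (θ+φ, θ)`. -/
theorem traceMap_factor_of_torus_automorphism :
    ∀ θ φ : ℝ, traceMap (semiConj (θ, φ)) = semiConj (θ + φ, θ) := by
  intro θ φ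
  have h := Real.two_mul_cos_mul_cos (2 * Real.pi * (θ + φ)) (2 * Real.pi * θ)
  rw [← mul_sub, ← mul_add, add_sub_cancel_left] at h
  simp only [traceMap, semiConj, h, add_sub_cancel_left]
end
end

section
/- The derivative (Jacobian matrix) of the trace map T at the fixed point P₁ = (1,1,1) is the matrix DT(P₁) = [[2,2,−1],[1,0,0],[0,1,0]], its characteristic polynomial equals (X+1)·(X² − 3X + 1), and hence its eigenvalues are −1, (3+√5)/2, and (3−√5)/2; the largest eigenvalue λ = (3+√5)/2 equals μ², where μ = (1+√5)/2. -/
noncomputable section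

open Polynomial

/-- The Jacobian matrix of the trace map at the fixed point `P₁ = (1,1,1)`. -/
def DTP1 : Matrix (Fin 3) (Fin 3) ℝ := !![2, 2, -1; 1, 0, 0; 0, 1, 0]

theorem DTP1_charpoly :
    DTP1.charpoly = (X + C 1) * (X ^ 2 - C 3 * X + C 1) := by
  have h2 : (C 2 : ℝ[X]) = 2 := rfl
  have h3 : (C 3 : ℝ[X]) = 3 := rfl
  simp [Matrix.charpoly, Matrix.charmatrix, DTP1, Matrix.det_fin_three, h2, h3]
  ring

theorem hasFDerivAt_traceMap (p : ℝ × ℝ × ℝ) :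
    ∃ L : ℝ × ℝ × ℝ →L[ℝ] ℝ × ℝ × ℝ,
      (∀ v : ℝ × ℝ × ℝ,
        L v = (2 * p.2.1 * v.1 + 2 * p.1 * v.2.1 - v.2.2, v.1, v.2.1)) ∧
      HasFDerivAt traceMap L p := by
  have hx := hasFDerivAt_fst (𝕜 := ℝ) (p := p)
  have hyz := hasFDerivAt_snd (𝕜 := ℝ) (p := p)
  have hy := hyz.fst
  have hz := hyz.snd
  refine ⟨_, fun v => ?_, (((hx.const_mul 2).mul hy).sub hz).prodMk (hx.prodMk hy)⟩
  simp
  ring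

theorem spectrum_DTP1 :
    spectrum ℝ DTP1 = {-1, (3 + Real.sqrt 5) / 2, (3 - Real.sqrt 5) / 2} := by
  have h5 : Real.sqrt 5 ^ 2 = 5 := Real.sq_sqrt (by norm_num)
  ext x
  have hfac : (X + C 1 : ℝ[X]).eval x * (X ^ 2 - C 3 * X + C 1 : ℝ[X]).eval x =
      (x + 1) * ((x - (3 + Real.sqrt 5) / 2) * (x - (3 - Real.sqrt 5) / 2)) := by
    simp only [eval_add, eval_sub, eval_mul, eval_pow, eval_X, eval_C]
    linear_combination (x + 1) / 4 * h5
  rw [Matrix.mem_spectrum_iff_isRoot_charpoly, DTP1_charpoly, IsRoot.def, eval_mul, hfac]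
  simp only [mul_eq_zero, sub_eq_zero, add_eq_zero_iff_eq_neg, Set.mem_insert_iff,
    Set.mem_singleton_iff]

/-- The derivative of the trace map at `P₁ = (1,1,1)` is `[[2,2,-1],[1,0,0],[0,1,0]]`, its
characteristic polynomial is `(X+1)(X² - 3X + 1)`, its eigenvalues are `-1, (3±√5)/2`, and
the largest eigenvalue `(3+√5)/2` equals `μ²` with `μ = (1+√5)/2`. -/
theorem derivative_at_singular_point :
    (∃ L : ℝ × ℝ × ℝ →L[ℝ] ℝ × ℝ × ℝ,
      (∀ v : ℝ × ℝ × ℝ, L v = (2 * v.1 + 2 * v.2.1 - v.2.2, v.1, v.2.1)) ∧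
      HasFDerivAt traceMap L (1, 1, 1)) ∧
    DTP1.charpoly = (X + C 1) * (X ^ 2 - C 3 * X + C 1) ∧
    spectrum ℝ DTP1 = {-1, (3 + Real.sqrt 5) / 2, (3 - Real.sqrt 5) / 2} ∧
    (3 + Real.sqrt 5) / 2 = ((1 + Real.sqrt 5) / 2) ^ 2 := by
  refine ⟨?_, DTP1_charpoly, spectrum_DTP1, ?_⟩
  · simpa using hasFDerivAt_traceMap (1, 1, 1)
  · have h5 : Real.sqrt 5 ^ 2 = 5 := Real.sq_sqrt (by norm_num)
    linear_combination -h5 / 4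
end
end

section
/- Let δ > 0, λ > δ, C₁ > 0, let N ∈ ℕ, and let b₀, …, b_{N−1} be nonnegative reals. Suppose real sequences (a_k), (A_k), (d_k), (D_k) for k = 0, …, N satisfy: d₀ = a₀, D₀ = A₀ > 0; for every 0 ≤ k ≤ N−1, d_{k+1} = (1+2δ)d_k + δD_k and D_{k+1} = (λ−δ)D_k − C₁·b_k·d_k, while a_{k+1} ≤ (1+2δ)a_k + δA_k and A_{k+1} ≥ (λ−δ)A_k − C₁·b_k·a_k; and a_k > 0, d_k > 0, D_k > 0 for all 0 ≤ k ≤ N. Then for all 0 ≤ k ≤ N one has A_k ≥ D_k and A_k·d_k ≥ D_k·a_k (i.e., A_k/a_k ≥ D_k/d_k). -/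
/-- Comparison step: sequences satisfying the recurrence inequalities dominate the sequences
satisfying the corresponding recurrence equalities with the same coefficients. -/
theorem recurrence_comparison (δ lam C₁ : ℝ) (hδ : 0 < δ) (hlam : δ < lam) (hC₁ : 0 < C₁)
    (N : ℕ) (b : ℕ → ℝ) (hb : ∀ k < N, 0 ≤ b k)
    (a A d D : ℕ → ℝ)
    (h0d : d 0 = a 0) (h0D : D 0 = A 0) (h0Dpos : 0 < D 0)
    (hd : ∀ k < N, d (k + 1) = (1 + 2 * δ) * d k + δ * D k)
    (hD : ∀ k < N, D (k + 1) = (lam - δ) * D k - C₁ * b k * d k)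
    (ha : ∀ k < N, a (k + 1) ≤ (1 + 2 * δ) * a k + δ * A k)
    (hA : ∀ k < N, A (k + 1) ≥ (lam - δ) * A k - C₁ * b k * a k)
    (hapos : ∀ k ≤ N, 0 < a k) (hdpos : ∀ k ≤ N, 0 < d k) (hDpos : ∀ k ≤ N, 0 < D k) :
    ∀ k ≤ N, A k ≥ D k ∧ A k * d k ≥ D k * a k := by
  intro k
  induction k with
  | zero =>
    intro _
    rw [h0d, h0D]
    exact ⟨le_rfl, le_rfl⟩
  | succ k ih =>
    intro hk
    have hkN : k < N := hk
    obtain ⟨hAD, hratio⟩ := ih hkN.le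
    have hDk := hDpos k hkN.le
    have hD' := hDpos (k + 1) hk
    have hd' := hdpos (k + 1) hk
    have hc : 0 ≤ C₁ * b k := mul_nonneg hC₁.le (hb k hkN)
    have hA_growth : A k * D (k + 1) ≤ D k * A (k + 1) := by
      have h₁ := mul_le_mul_of_nonneg_left (hA k hkN) hDk.le
      have h₂ := mul_le_mul_of_nonneg_left hratio hc
      rw [hD k hkN]
      linarith
    have ha_growth : D k * a (k + 1) ≤ A k * d (k + 1) := by
      have h₁ := mul_le_mul_of_nonneg_left (ha k hkN) hDk.le
      have h₂ := mul_le_mul_of_nonneg_left hratio (by linarith : 0 ≤ 1 + 2 * δ)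
      rw [hd k hkN]
      linarith
    constructor
    · refine le_of_mul_le_mul_left ?_ hDk
      exact (mul_le_mul_of_nonneg_right hAD hD'.le).trans hA_growth
    · refine le_of_mul_le_mul_left ?_ hDk
      have h₁ := mul_le_mul_of_nonneg_right hA_growth hd'.le
      have h₂ := mul_le_mul_of_nonneg_right ha_growth hD'.le
      linarith
end
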